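/- arXiv:1809.06774 — 5 statements merged into one kernel-verified Lean document; each statement's English description precedes it below -/
import Mathlib

section
/- For any coded prae-dilator T and any linear order (X, <_X), the relation <_{D^T_X} is a linear order on D^T_X (it is irreflexive, transitive, and any two distinct elements are comparable). -/
structure PraeDilator where
  A : ℕ → Type
  inst : ∀ n, LinearOrder (A n)
  map : ∀ {n m : ℕ}, (Fin n ↪o Fin m) → A n → A m
  map_strictMono : ∀ {n m : ℕ} (f : Fin n ↪o Fin m) (σ τ : A n),
      (inst n).lt σ τ → (inst m).lt (map f σ) (map f τ)
  map_id : ∀ (n : ℕ) (σ : A n), map (OrderIso.refl (Fin n)).toOrderEmbedding σ = σ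
  map_comp : ∀ {n m k : ℕ} (f : Fin n ↪o Fin m) (g : Fin m ↪o Fin k) (σ : A n),
      map (f.trans g) σ = map g (map f σ)
  supp : ∀ n, A n → Finset (Fin n)
  supp_natural : ∀ {n m : ℕ} (f : Fin n ↪o Fin m) (σ : A n),
      supp m (map f σ) = (supp n σ).map f.toEmbedding
  supp_spec : ∀ (n : ℕ) (σ : A n),
      ∃ τ : A (supp n σ).card, map ((supp n σ).orderEmbOfFin rfl) τ = σ

attribute [instance] PraeDilator.inst



/-- The strictly increasing map `Fin a.card ↪o Fin d.card` induced by an inclusion `a ⊆ d`. -/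
def inclEmb {X : Type} [LinearOrder X] {a d : Finset X} (h : a ⊆ d) :
    Fin a.card ↪o Fin d.card :=
  OrderEmbedding.ofStrictMono
    (fun i => (d.orderIsoOfFin rfl).symm ⟨a.orderEmbOfFin rfl i, h (a.orderEmbOfFin_mem rfl i)⟩)
    (fun i j hij => by
      apply (d.orderIsoOfFin rfl).symm.strictMono
      exact Subtype.mk_lt_mk.mpr ((a.orderEmbOfFin rfl).strictMono hij))

structure DApp (D : PraeDilator) (X : Type) [LinearOrder X] where
  a : Finset X
  σ : D.A a.card
  hsupp : D.supp a.card σ = Finset.univ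

def DLt (D : PraeDilator) (X : Type) [LinearOrder X] (x y : DApp D X) : Prop :=
  D.map (inclEmb (Finset.subset_union_left : x.a ⊆ x.a ∪ y.a)) x.σ <
    D.map (inclEmb (Finset.subset_union_right : y.a ⊆ x.a ∪ y.a)) y.σ

lemma orderEmbOfFin_inclEmb {X : Type} [LinearOrder X] {a d : Finset X} (h : a ⊆ d)
    (i : Fin a.card) : d.orderEmbOfFin rfl (inclEmb h i) = a.orderEmbOfFin rfl i := by
  change ((d.orderIsoOfFin rfl) ((d.orderIsoOfFin rfl).symm _) : X) = _
  rw [OrderIso.apply_symm_apply]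

lemma inclEmb_trans {X : Type} [LinearOrder X] {a b d : Finset X} (h : a ⊆ b) (h' : b ⊆ d) :
    (inclEmb h).trans (inclEmb h') = inclEmb (h.trans h') := by
  ext i : 1
  apply (d.orderEmbOfFin rfl).injective
  simp [orderEmbOfFin_inclEmb]

lemma image_inclEmb_univ {X : Type} [LinearOrder X] {a d : Finset X} (h : a ⊆ d) :
    ((Finset.univ : Finset (Fin a.card)).map (inclEmb h).toEmbedding).map
      (d.orderEmbOfFin rfl).toEmbedding = a := by
  ext x
  have hx : x ∈ Set.range (a.orderEmbOfFin rfl) ↔ x ∈ a := by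
    rw [Finset.range_orderEmbOfFin, Finset.mem_coe]
  simp only [Finset.mem_map, Finset.mem_univ, true_and, RelEmbedding.coe_toEmbedding,
    exists_exists_eq_and, orderEmbOfFin_inclEmb]
  exact hx

lemma PraeDilator.strictMono_map (D : PraeDilator) {n m : ℕ} (f : Fin n ↪o Fin m) :
    StrictMono (D.map f) :=
  fun σ τ => D.map_strictMono f σ τ

/-- The comparison of two elements may be carried out over any finite set containing both
supports. -/
lemma DLt_iff_of_subset {D : PraeDilator} {X : Type} [LinearOrder X] {x y : DApp D X}
    {d : Finset X} (hx : x.a ⊆ d) (hy : y.a ⊆ d) :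
    DLt D X x y ↔ D.map (inclEmb hx) x.σ < D.map (inclEmb hy) y.σ := by
  have hd : x.a ∪ y.a ⊆ d := Finset.union_subset hx hy
  rw [DLt, ← (D.strictMono_map (inclEmb hd)).lt_iff_lt, ← D.map_comp, ← D.map_comp,
    inclEmb_trans, inclEmb_trans]

lemma DApp.eq_of_map_inclEmb_eq {D : PraeDilator} {X : Type} [LinearOrder X] {x y : DApp D X}
    {d : Finset X} (hx : x.a ⊆ d) (hy : y.a ⊆ d)
    (h : D.map (inclEmb hx) x.σ = D.map (inclEmb hy) y.σ) : x = y := by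
  have ha : x.a = y.a := by
    have hs := congrArg (D.supp _) h
    rw [D.supp_natural, D.supp_natural, x.hsupp, y.hsupp] at hs
    rw [← image_inclEmb_univ hx, hs, image_inclEmb_univ hy]
  obtain ⟨a, σ, hσ⟩ := x
  obtain ⟨b, τ, hτ⟩ := y
  obtain rfl : a = b := ha
  obtain rfl : σ = τ := (D.strictMono_map (inclEmb hx)).injective h
  rfl

/-- For any coded prae-dilator `T` and any linear order `X`, the relation
`<_{D^T_X}` is a linear order on `D^T_X`: irreflexive, transitive, and any two distinct
elements are comparable. -/
theorem DLt_isLinearOrder (D : PraeDilator) (X : Type) [LinearOrder X] :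
    (∀ x : DApp D X, ¬ DLt D X x x) ∧
    (∀ x y z : DApp D X, DLt D X x y → DLt D X y z → DLt D X x z) ∧
    (∀ x y : DApp D X, x ≠ y → DLt D X x y ∨ DLt D X y x) := by
  refine ⟨fun x h => lt_irrefl _ h, fun x y z hxy hyz => ?_, fun x y hne => ?_⟩
  · have hx : x.a ⊆ x.a ∪ y.a ∪ z.a :=
      Finset.subset_union_left.trans Finset.subset_union_left
    have hy : y.a ⊆ x.a ∪ y.a ∪ z.a :=
      Finset.subset_union_right.trans Finset.subset_union_left
    have hz : z.a ⊆ x.a ∪ y.a ∪ z.a := Finset.subset_union_right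
    rw [DLt_iff_of_subset hx hy] at hxy
    rw [DLt_iff_of_subset hy hz] at hyz
    rw [DLt_iff_of_subset hx hz]
    exact hxy.trans hyz
  · have hx : x.a ⊆ x.a ∪ y.a := Finset.subset_union_left
    have hy : y.a ⊆ x.a ∪ y.a := Finset.subset_union_right
    rw [DLt_iff_of_subset hx hy, DLt_iff_of_subset hy hx]
    exact lt_or_gt_of_ne fun h => hne (DApp.eq_of_map_inclEmb_eq hx hy h)
end

section
/- Let X and Y be linear orders and equip T_Y := X ×ₗ (WithBot Y), the lexicographic product of X with Y extended by a new bottom element ⊥, with the support function supp(x,y) := {y} if y ∈ Y and supp(x,⊥) := ∅. If ϑ : T_Y → Y is a Bachmann-Howard collapse, then the function f : ω^X → WithBot Y defined recursively by f(⟨⟩) := ⊥ and f(⟨x₀,…,x_n⟩) := ϑ(x₀, f(⟨x₁,…,x_n⟩)) is strictly increasing. Consequently, if Y is well-founded, then ω^X is well-founded. -/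
/-- The underlying set of the notation system `ω^X`: finite weakly decreasing sequences
`⟨x₀,…,x_{n−1}⟩` (with `x_{n−1} ≤ … ≤ x₀`) of elements of `X`. -/
def OmegaPow (X : Type) [LinearOrder X] : Type :=
  {l : List X // l.Chain' (· ≥ ·)}

/-- The order on `ω^X` is the lexicographic order on the underlying sequences. -/
def OmegaPowLt (X : Type) [LinearOrder X] (s t : OmegaPow X) : Prop :=
  List.Lex (· < ·) s.val t.val

/-- `θ : A → X` is a Bachmann-Howard collapse with respect to the relations `ltA`, `ltX` and
the support function `supp`. -/
def IsBHCollapse {A X : Type} (ltA : A → A → Prop) (ltX : X → X → Prop)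
    (supp : A → Finset X) (θ : A → X) : Prop :=
  (∀ σ τ : A, ltA σ τ → (∀ x ∈ supp σ, ltX x (θ τ)) → ltX (θ σ) (θ τ)) ∧
  (∀ σ : A, ∀ x ∈ supp σ, ltX x (θ σ))

/-- The support function on `T_Y = X ×ₗ (WithBot Y)`: `supp (x,y) = {y}` for `y ∈ Y` and
`supp (x,⊥) = ∅`. -/
def suppXY (X Y : Type) : X × WithBot Y → Finset Y :=
  fun p => p.2.recBotCoe ∅ (fun y => {y})

/-- The function `f : ω^X → WithBot Y` with `f(⟨⟩) = ⊥` and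
`f(⟨x₀,…,x_n⟩) = ϑ(x₀, f(⟨x₁,…,x_n⟩))`, defined on underlying lists. -/
def collapseSeq {X Y : Type} (θ : X × WithBot Y → Y) : List X → WithBot Y
  | [] => ⊥
  | x :: l => (θ (x, collapseSeq θ l) : Y)

theorem lt_coe_of_forall_mem_suppXY {X Y : Type} [LinearOrder Y] {x : X} {b : WithBot Y} {z : Y} :
    (∀ y ∈ suppXY X Y (x, b), y < z) ↔ b < (z : WithBot Y) := by
  cases b with
  | bot => simp [suppXY]
  | coe y => simp [suppXY]

theorem collapseSeq_lt_of_lex {X Y : Type} [LinearOrder X] [LinearOrder Y]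
    (θ : X × WithBot Y → Y)
    (hθ : IsBHCollapse (Prod.Lex ((· < ·) : X → X → Prop) ((· < ·) : WithBot Y → WithBot Y → Prop))
      ((· < ·) : Y → Y → Prop) (suppXY X Y) θ)
    {s t : List X} (hs : s.IsChain (· ≥ ·)) (hst : List.Lex (· < ·) s t) :
    collapseSeq θ s < collapseSeq θ t := by
  induction s generalizing t with
  | nil =>
    cases hst with
    | nil => exact WithBot.bot_lt_coe _
  | cons x s ih =>
    cases hst with
    | @cons _ _ t h =>
      have hlt := ih hs.tail h
      exact WithBot.coe_lt_coe.2 (hθ.1 _ _ (Prod.Lex.right _ hlt)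
        (lt_coe_of_forall_mem_suppXY.2
          (hlt.trans (lt_coe_of_forall_mem_suppXY.1 (hθ.2 (x, collapseSeq θ t))))))
    | @rel _ _ y t h =>
      have hlex : List.Lex (· < ·) s (y :: t) := by
        cases s with
        | nil => exact List.Lex.nil
        | cons z s => exact List.Lex.rel ((List.isChain_cons_cons.1 hs).1.trans_lt h)
      exact WithBot.coe_lt_coe.2 (hθ.1 _ _ (Prod.Lex.left _ _ h)
        (lt_coe_of_forall_mem_suppXY.2 (ih hs.tail hlex)))

/-- Let `X`, `Y` be linear orders and equip `T_Y := X ×ₗ (WithBot Y)` (the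
lexicographic product) with the support function `supp(x,y) := {y}`, `supp(x,⊥) := ∅`. If
`ϑ : T_Y → Y` is a Bachmann-Howard collapse, then `f : ω^X → WithBot Y` defined by
`f(⟨⟩) := ⊥`, `f(⟨x₀,…,x_n⟩) := ϑ(x₀, f(⟨x₁,…,x_n⟩))` is strictly increasing. Consequently,
if `Y` is well-founded, then `ω^X` is well-founded. -/
theorem collapseSeq_strictMono_and_wf {X Y : Type} [LinearOrder X] [LinearOrder Y]
    (θ : X × WithBot Y → Y)
    (hθ : IsBHCollapse (Prod.Lex ((· < ·) : X → X → Prop) ((· < ·) : WithBot Y → WithBot Y → Prop))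
      ((· < ·) : Y → Y → Prop) (suppXY X Y) θ) :
    (∀ s t : OmegaPow X, OmegaPowLt X s t → collapseSeq θ s.val < collapseSeq θ t.val) ∧
    (WellFounded ((· < ·) : Y → Y → Prop) → WellFounded (OmegaPowLt X)) := by
  have hmono (s t : OmegaPow X) (h : OmegaPowLt X s t) :
      collapseSeq θ s.val < collapseSeq θ t.val := collapseSeq_lt_of_lex θ hθ s.property h
  refine ⟨hmono, fun hwf => ?_⟩
  have : WellFoundedLT Y := ⟨hwf⟩
  exact Subrelation.wf (fun {s t} h => hmono s t h)
    (InvImage.wf (fun s : OmegaPow X => collapseSeq θ s.val) (wellFounded_lt (α := WithBot Y)))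
end

section
/- If (X, <_X) is a linear order, then (ε_X, <_{ε_X}) is a linear order. -/
/-- Raw terms of the notation system `ε_X`: `0`, `ε_x` for `x ∈ X`, and ω-sums
`ω^{t₀} + … + ω^{t_n}`. -/
inductive EpsTerm (X : Type) : Type where
  | zero : EpsTerm X
  | eps (x : X) : EpsTerm X
  | omega (ts : List (EpsTerm X)) : EpsTerm X

variable {X : Type} [LinearOrder X]

/-- The order `<_{ε_X}` on terms: `0` is least; `ε_x < ε_y` iff `x < y`;
`ε_x < ω^{t₀}+…+ω^{t_m}` iff `ε_x ≤ t₀`; `ω^{t₀}+…+ω^{t_n} < ε_x` iff `t₀ < ε_x`; and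
ω-sums are compared lexicographically on their exponents (a proper initial segment being
smaller). -/
inductive EpsLt : EpsTerm X → EpsTerm X → Prop where
  | zero_eps (x : X) : EpsLt .zero (.eps x)
  | zero_omega (ts : List (EpsTerm X)) : EpsLt .zero (.omega ts)
  | eps_eps {x y : X} : x < y → EpsLt (.eps x) (.eps y)
  | eps_omega_lt {x : X} {t₀ : EpsTerm X} (ts : List (EpsTerm X)) :
      EpsLt (.eps x) t₀ → EpsLt (.eps x) (.omega (t₀ :: ts))
  | eps_omega_eq (x : X) (ts : List (EpsTerm X)) :
      EpsLt (.eps x) (.omega (.eps x :: ts))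
  | omega_eps {x : X} {t₀ : EpsTerm X} (ts : List (EpsTerm X)) :
      EpsLt t₀ (.eps x) → EpsLt (.omega (t₀ :: ts)) (.eps x)
  | omega_nil (t : EpsTerm X) (ts : List (EpsTerm X)) : EpsLt (.omega []) (.omega (t :: ts))
  | omega_head {s t : EpsTerm X} (ss ts : List (EpsTerm X)) :
      EpsLt s t → EpsLt (.omega (s :: ss)) (.omega (t :: ts))
  | omega_tail {ss ts : List (EpsTerm X)} (s : EpsTerm X) :
      EpsLt (.omega ss) (.omega ts) → EpsLt (.omega (s :: ss)) (.omega (s :: ts))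

/-- Well-formed terms of `ε_X`: in an ω-sum with a single exponent the exponent must not be
of the form `ε_x`, and with several exponents they must be weakly decreasing. -/
inductive EpsWF : EpsTerm X → Prop where
  | zero : EpsWF .zero
  | eps (x : X) : EpsWF (.eps x)
  | omega_single (t : EpsTerm X) : EpsWF t → (∀ x : X, t ≠ .eps x) → EpsWF (.omega [t])
  | omega_many (ts : List (EpsTerm X)) : 2 ≤ ts.length → (∀ t ∈ ts, EpsWF t) →
      ts.Chain' (fun a b => EpsLt b a ∨ b = a) → EpsWF (.omega ts)

/-- No proper subterm of the given term is the empty ω-sum. -/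
inductive EpsTerm.NonemptyExponents {X : Type} : EpsTerm X → Prop where
  | zero : NonemptyExponents .zero
  | eps (x : X) : NonemptyExponents (.eps x)
  | omega_nil : NonemptyExponents (.omega [])
  | omega_cons {t : EpsTerm X} {ts : List (EpsTerm X)} : NonemptyExponents t → t ≠ .omega [] →
      NonemptyExponents (.omega ts) → NonemptyExponents (.omega (t :: ts))

open EpsTerm (NonemptyExponents)

theorem EpsTerm.NonemptyExponents.omega {X : Type} {ts : List (EpsTerm X)}
    (h : ∀ t ∈ ts, t.NonemptyExponents ∧ t ≠ .omega []) :
    NonemptyExponents (.omega ts) := by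
  induction ts with
  | nil => exact .omega_nil
  | cons t ts ih =>
    obtain ⟨ht, htn⟩ := h t (by simp)
    exact .omega_cons ht htn (ih fun s hs => h s (by simp [hs]))

theorem EpsWF.nonemptyExponents {t : EpsTerm X} (h : EpsWF t) :
    t.NonemptyExponents ∧ t ≠ .omega [] := by
  induction h with
  | zero => exact ⟨.zero, nofun⟩
  | eps x => exact ⟨.eps x, nofun⟩
  | omega_single t _ _ ih => exact ⟨.omega_cons ih.1 ih.2 .omega_nil, nofun⟩
  | omega_many ts hlen _ _ ih =>
    refine ⟨.omega ih, ?_⟩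
    rintro ⟨⟩
    simp at hlen

theorem EpsLt.ne {s t : EpsTerm X} (h : EpsLt s t) : s ≠ t := by
  induction h with
  | eps_eps hxy => simpa using hxy.ne
  | omega_head _ _ _ ih => simp [ih]
  | omega_tail _ _ ih => simpa using ih
  | _ => simp

theorem EpsLt.eps_trans {x y : X} {u : EpsTerm X} (hxy : x < y)
    (h : EpsLt (.eps y) u) : EpsLt (.eps x) u := by
  generalize hs : EpsTerm.eps y = s at h
  induction h with
  | eps_eps hyz =>
    cases hs
    exact .eps_eps (hxy.trans hyz)
  | eps_omega_lt ts _ ih => exact .eps_omega_lt ts (ih hs)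
  | eps_omega_eq =>
    cases hs
    exact .eps_omega_lt _ (.eps_eps hxy)
  | _ => cases hs

/-- Transitivity on raw terms fails only for `ω`-sums `s` that are, or contain, the empty sum: the
latter lies below all other sums but is incomparable with every `ε_x`. -/
theorem EpsLt.trans_of_nonemptyExponents {s t u : EpsTerm X}
    (hst : EpsLt s t) (htu : EpsLt t u) (hs : s.NonemptyExponents)
    (hsu : s ≠ .omega [] ∨ ∀ x, u ≠ .eps x) : EpsLt s u := by
  induction hst generalizing u with
  | zero_eps x =>
    cases u with
    | zero => cases htu
    | eps y => exact .zero_eps y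
    | omega us => exact .zero_omega us
  | zero_omega ts =>
    cases u with
    | zero => cases htu
    | eps y => exact .zero_eps y
    | omega us => exact .zero_omega us
  | eps_eps hxy => exact htu.eps_trans hxy
  | eps_omega_lt ts hlt ih =>
    cases htu with
    | omega_eps _ h => exact ih h hs (.inl nofun)
    | omega_head _ _ h => exact .eps_omega_lt _ (ih h hs (.inl nofun))
    | omega_tail _ h => exact .eps_omega_lt _ hlt
  | eps_omega_eq x ts =>
    cases htu with
    | omega_eps _ h => exact h
    | omega_head _ _ h => exact .eps_omega_lt _ h
    | omega_tail _ h => exact .eps_omega_eq _ _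
  | omega_eps ts _ ih =>
    cases hs with | omega_cons ht htn _
    cases htu with
    | eps_eps h => exact .omega_eps _ (ih (.eps_eps h) ht (.inl htn))
    | eps_omega_lt _ h => exact .omega_head _ _ (ih h ht (.inl htn))
    | eps_omega_eq => exact .omega_head _ _ ‹_›
  | omega_nil t ts =>
    cases htu with
    | omega_eps => simp at hsu
    | omega_head => exact .omega_nil _ _
    | omega_tail => exact .omega_nil _ _
  | omega_head ss ts hlt ih =>
    cases hs with | omega_cons ht htn _
    cases htu with
    | omega_eps _ h => exact .omega_eps _ (ih h ht (.inl htn))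
    | omega_head _ _ h => exact .omega_head _ _ (ih h ht (.inl htn))
    | omega_tail _ h => exact .omega_head _ _ hlt
  | omega_tail s _ ih =>
    cases hs with | omega_cons _ _ hss
    cases htu with
    | omega_eps _ h => exact .omega_eps _ h
    | omega_head _ _ h => exact .omega_head _ _ h
    | omega_tail _ h => exact .omega_tail _ (ih h hss (.inr nofun))

theorem EpsLt.trichotomous_eps (x : X) {t : EpsTerm X}
    (ht : t.NonemptyExponents) (htn : t ≠ .omega []) :
    EpsLt (.eps x) t ∨ .eps x = t ∨ EpsLt t (.eps x) := by
  induction ht with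
  | zero => exact .inr (.inr (.zero_eps x))
  | eps y =>
    rcases lt_trichotomy x y with h | rfl | h
    · exact .inl (.eps_eps h)
    · exact .inr (.inl rfl)
    · exact .inr (.inr (.eps_eps h))
  | omega_nil => exact absurd rfl htn
  | omega_cons _ hn _ ih _ =>
    rcases ih hn with h | rfl | h
    · exact .inl (.eps_omega_lt _ h)
    · exact .inl (.eps_omega_eq _ _)
    · exact .inr (.inr (.omega_eps _ h))

theorem EpsLt.trichotomous_of_nonemptyExponents {s t : EpsTerm X}
    (hs : s.NonemptyExponents) (ht : t.NonemptyExponents)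
    (hst : s ≠ .omega [] ∨ ∀ x, t ≠ .eps x) (hts : t ≠ .omega [] ∨ ∀ x, s ≠ .eps x) :
    EpsLt s t ∨ s = t ∨ EpsLt t s := by
  induction hs generalizing t with
  | zero =>
    cases t with
    | zero => exact .inr (.inl rfl)
    | eps y => exact .inl (.zero_eps y)
    | omega ts => exact .inl (.zero_omega ts)
  | eps x => exact trichotomous_eps x ht (hts.resolve_right fun h => h x rfl)
  | omega_nil =>
    rcases t with _ | y | _ | ⟨t, ts⟩
    · exact .inr (.inr (.zero_omega _))
    · simp at hst
    · exact .inr (.inl rfl)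
    · exact .inl (.omega_nil t ts)
  | omega_cons hs hsn hss ih ihs =>
    cases ht with
    | zero => exact .inr (.inr (.zero_omega _))
    | eps y =>
      rcases trichotomous_eps y (.omega_cons hs hsn hss) nofun with h | h | h
      · exact .inr (.inr h)
      · exact .inr (.inl h.symm)
      · exact .inl h
    | omega_nil => exact .inr (.inr (.omega_nil _ _))
    | omega_cons ht htn htl =>
      rcases ih ht (.inl hsn) (.inl htn) with h | rfl | h
      · exact .inl (.omega_head _ _ h)
      · rcases ihs htl (.inr nofun) (.inr nofun) with h | h | h
        · exact .inl (.omega_tail _ h)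
        · cases h
          exact .inr (.inl rfl)
        · exact .inr (.inr (.omega_tail _ h))
      · exact .inr (.inr (.omega_head _ _ h))


/-- If `(X, <_X)` is a linear order, then `(ε_X, <_{ε_X})` is a linear order:
on well-formed terms the relation `<_{ε_X}` is irreflexive, transitive, and any two distinct
terms are comparable. -/
theorem epsX_linearOrder (X : Type) [LinearOrder X] :
    (∀ s : {t : EpsTerm X // EpsWF t}, ¬ EpsLt s.val s.val) ∧
    (∀ s t u : {t : EpsTerm X // EpsWF t},
      EpsLt s.val t.val → EpsLt t.val u.val → EpsLt s.val u.val) ∧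
    (∀ s t : {t : EpsTerm X // EpsWF t}, s ≠ t → EpsLt s.val t.val ∨ EpsLt t.val s.val) := by
  refine ⟨fun s h => h.ne rfl, fun s t u hst htu => ?_, fun s t hne => ?_⟩
  · obtain ⟨hs, hsn⟩ := s.2.nonemptyExponents
    exact hst.trans_of_nonemptyExponents htu hs (.inl hsn)
  · obtain ⟨hs, hsn⟩ := s.2.nonemptyExponents
    obtain ⟨ht, htn⟩ := t.2.nonemptyExponents
    rcases EpsLt.trichotomous_of_nonemptyExponents hs ht (.inl hsn) (.inl htn) with h | h | h
    · exact .inl h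
    · exact absurd (Subtype.ext h) hne
    · exact .inr h
end

section
/- For any coded prae-dilator T, the relation <_{ϑ(T)} is a linear order on ϑ(T): it is irreflexive, transitive, and any two distinct terms are comparable. -/
/-- Terms of the notation system `ϑ(T)`: a term `ϑ_σ^{s₀,…,s_{n−1}}` consists of a finite
sequence of previously constructed terms together with an element `σ ∈ T_n`. -/
inductive ThT (D : PraeDilator) : Type where
  | node (n : ℕ) (ss : Fin n → ThT D) (σ : D.A n) : ThT D

/-- Size of a term of `ϑ(T)`. -/
def tsizeT (D : PraeDilator) : ThT D → ℕ
  | .node _ ss _ => (Finset.univ.sum fun i => tsizeT D (ss i)) + 1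

theorem tsizeT_lt (D : PraeDilator) (n : ℕ) (ss : Fin n → ThT D) (σ : D.A n) (i : Fin n) :
    tsizeT D (ss i) < tsizeT D (.node n ss σ) := by
  have : tsizeT D (ss i) ≤ Finset.univ.sum fun j => tsizeT D (ss j) :=
    Finset.single_le_sum (f := fun j => tsizeT D (ss j)) (fun _ _ => Nat.zero_le _) (Finset.mem_univ i)
  calc tsizeT D (ss i) ≤ _ := this
    _ < _ + 1 := Nat.lt_succ_self _
    _ = tsizeT D (.node n ss σ) := by rw [tsizeT]

/-- The relation `<_{ϑ(T)}` on terms of `ϑ(T)`, following the simultaneous recursive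
definition: `ϑ_σ^{s₀,…,s_{n−1}} < ϑ_τ^{t₀,…,t_{m−1}}` iff either (i') `T_f(σ) <_{T_k} T_g(τ)`
for the strictly increasing `f : n → k` and `g : m → k` onto `k = |{s₀,…,t_{m−1}}|` with
`f i < g j ↔ s_i < t_j` and `g j < f i ↔ t_j < s_i`, together with `n = 0` or `s_{n−1} < t`;
or (ii') `m > 0` and `s ≤ t_{m−1}`. -/
def tlt (D : PraeDilator) : ThT D → ThT D → Prop
  | .node n ss σ, .node m ts τ =>
    ((∃ (k : ℕ) (f : Fin n ↪o Fin k) (g : Fin m ↪o Fin k),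
      (∀ (i : Fin n) (j : Fin m), f i < g j ↔ tlt D (ss i) (ts j)) ∧
      (∀ (i : Fin n) (j : Fin m), g j < f i ↔ tlt D (ts j) (ss i)) ∧
      (∀ p : Fin k, (∃ i, f i = p) ∨ (∃ j, g j = p)) ∧
      D.map f σ < D.map g τ) ∧
      (∀ h : 0 < n, tlt D (ss ⟨n - 1, Nat.sub_lt h Nat.one_pos⟩) (.node m ts τ))) ∨
    (∃ h : 0 < m,
      tlt D (.node n ss σ) (ts ⟨m - 1, Nat.sub_lt h Nat.one_pos⟩) ∨
      ThT.node n ss σ = ts ⟨m - 1, Nat.sub_lt h Nat.one_pos⟩)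
termination_by s t => tsizeT D s + tsizeT D t
decreasing_by
  · have h1 := tsizeT_lt D n ss σ i
    have h2 := tsizeT_lt D m ts τ j
    omega
  · have h1 := tsizeT_lt D m ts τ j
    have h2 := tsizeT_lt D n ss σ i
    omega
  · have h1 := tsizeT_lt D n ss σ ⟨n - 1, Nat.sub_lt h Nat.one_pos⟩
    omega
  · have h1 := tsizeT_lt D m ts τ ⟨m - 1, Nat.sub_lt h Nat.one_pos⟩
    omega

/-- Well-formed terms of `ϑ(T)`: in `ϑ_σ^{s₀,…,s_{n−1}}` the listed terms must be
well-formed and strictly increasing, and `σ ∈ T_n` must have full support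
`supp^T_n(σ) = {0,…,n−1}`. -/
inductive ThTWF (D : PraeDilator) : ThT D → Prop where
  | node (n : ℕ) (ss : Fin n → ThT D) (σ : D.A n) :
      (∀ i, ThTWF D (ss i)) → (∀ i j : Fin n, i < j → tlt D (ss i) (ss j)) →
      D.supp n σ = Finset.univ → ThTWF D (.node n ss σ)

theorem PraeDilator.map_lt_map_iff (D : PraeDilator) {n m : ℕ} (f : Fin n ↪o Fin m)
    (σ τ : D.A n) : D.map f σ < D.map f τ ↔ σ < τ :=
  StrictMono.lt_iff_lt (f := D.map f) (fun _ _ h => D.map_strictMono f _ _ h)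

theorem PraeDilator.map_injective (D : PraeDilator) {n m : ℕ} (f : Fin n ↪o Fin m) :
    Function.Injective (D.map f) :=
  StrictMono.injective (f := D.map f) (fun _ _ h => D.map_strictMono f _ _ h)

/-- Elements of full support that agree after renaming come from the same arity and renaming. -/
theorem PraeDilator.eq_of_map_eq (D : PraeDilator) {n m K : ℕ} {σ : D.A n} {τ : D.A m}
    (hσ : D.supp n σ = Finset.univ) (hτ : D.supp m τ = Finset.univ)
    (F : Fin n ↪o Fin K) (G : Fin m ↪o Fin K) (h : D.map F σ = D.map G τ) :
    ∃ e : n = m, e ▸ F = G ∧ e ▸ σ = τ := by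
  have hs : Finset.univ.map F.toEmbedding = Finset.univ.map G.toEmbedding := by
    rw [← hσ, ← hτ, ← D.supp_natural, ← D.supp_natural, h]
  obtain rfl : n = m := by simpa using congrArg Finset.card hs
  have hFG : F = G := by
    apply DFunLike.coe_injective
    rw [← F.strictMono.range_inj G.strictMono]
    simpa using congrArg (fun s : Finset (Fin K) => (s : Set (Fin K))) hs
  subst hFG
  exact ⟨rfl, rfl, D.map_injective F h⟩

/-- A jointly surjective pair of embeddings is initial among pairs with the same order pattern. -/
theorem exists_orderEmbedding_lift {n m k K : ℕ} (f : Fin n ↪o Fin k) (g : Fin m ↪o Fin k)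
    (F : Fin n ↪o Fin K) (G : Fin m ↪o Fin K)
    (hcover : ∀ p : Fin k, (∃ i, f i = p) ∨ (∃ j, g j = p))
    (h₁ : ∀ i j, f i < g j ↔ F i < G j) (h₂ : ∀ i j, g j < f i ↔ G j < F i) :
    ∃ h : Fin k ↪o Fin K, f.trans h = F ∧ g.trans h = G := by
  have heq : ∀ i j, f i = g j → F i = G j := fun i j hij =>
    le_antisymm (not_lt.1 fun h => ((h₂ i j).2 h).ne hij.symm)
      (not_lt.1 fun h => ((h₁ i j).2 h).ne hij)
  have hval : ∀ p : Fin k, ∃ q : Fin K,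
      (∀ i, f i = p → F i = q) ∧ (∀ j, g j = p → G j = q) := by
    intro p
    rcases hcover p with ⟨i, rfl⟩ | ⟨j, rfl⟩
    · exact ⟨F i, fun i' h => by rw [f.injective h], fun j h => (heq i j h.symm).symm⟩
    · exact ⟨G j, fun i h => heq i j h, fun j' h => by rw [g.injective h]⟩
  choose h hf hg using hval
  have hmono : StrictMono h := by
    intro p q hpq
    rcases hcover p with ⟨i, rfl⟩ | ⟨j, rfl⟩ <;> rcases hcover q with ⟨i', rfl⟩ | ⟨j', rfl⟩
    · rw [← hf _ i rfl, ← hf _ i' rfl]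
      exact F.strictMono (f.lt_iff_lt.1 hpq)
    · rw [← hf _ i rfl, ← hg _ j' rfl]
      exact (h₁ _ _).1 hpq
    · rw [← hg _ j rfl, ← hf _ i' rfl]
      exact (h₂ _ _).1 hpq
    · rw [← hg _ j rfl, ← hg _ j' rfl]
      exact G.strictMono (g.lt_iff_lt.1 hpq)
  refine ⟨OrderEmbedding.ofStrictMono h hmono, ?_, ?_⟩
  · ext i
    simp [← hf _ i rfl]
  · ext j
    simp [← hg _ j rfl]

/-- A strictly increasing sequence in a finite set factors through the enumeration of the set. -/
theorem exists_factor_orderEmbOfFin {X : Type*} [LinearOrder X] (d : Finset X) {n : ℕ}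
    (a : Fin n → X) (ha : StrictMono a) (hd : ∀ i, a i ∈ d) :
    ∃ f : Fin n ↪o Fin d.card, ∀ i, d.orderEmbOfFin rfl (f i) = a i := by
  have hex : ∀ i, ∃ p, d.orderEmbOfFin rfl p = a i := by
    intro i
    have h : a i ∈ Set.range (d.orderEmbOfFin rfl) := by
      rw [Finset.range_orderEmbOfFin]
      exact hd i
    exact h
  choose f hf using hex
  refine ⟨OrderEmbedding.ofStrictMono f fun i j hij => ?_, hf⟩
  rw [← (d.orderEmbOfFin rfl).lt_iff_lt, hf, hf]
  exact ha hij

/-- The comparison of `T_f(σ)` and `T_g(τ)` in clause (i') of `tlt`. -/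
def ArgLt (D : PraeDilator) {n m : ℕ} (ss : Fin n → ThT D) (σ : D.A n) (ts : Fin m → ThT D)
    (τ : D.A m) : Prop :=
  ∃ (k : ℕ) (f : Fin n ↪o Fin k) (g : Fin m ↪o Fin k),
    (∀ (i : Fin n) (j : Fin m), f i < g j ↔ tlt D (ss i) (ts j)) ∧
    (∀ (i : Fin n) (j : Fin m), g j < f i ↔ tlt D (ts j) (ss i)) ∧
    (∀ p : Fin k, (∃ i, f i = p) ∨ (∃ j, g j = p)) ∧
    D.map f σ < D.map g τ

/-- Embeddings `F` and `G` realize the order pattern of two families of terms. -/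
def OrderPattern (D : PraeDilator) {n m K : ℕ} (ss : Fin n → ThT D) (ts : Fin m → ThT D)
    (F : Fin n ↪o Fin K) (G : Fin m ↪o Fin K) : Prop :=
  (∀ i j, F i < G j ↔ tlt D (ss i) (ts j)) ∧ (∀ i j, G j < F i ↔ tlt D (ts j) (ss i))

theorem OrderPattern.symm {D : PraeDilator} {n m K : ℕ} {ss : Fin n → ThT D}
    {ts : Fin m → ThT D} {F : Fin n ↪o Fin K} {G : Fin m ↪o Fin K}
    (h : OrderPattern D ss ts F G) : OrderPattern D ts ss G F :=
  ⟨fun i j => h.2 j i, fun i j => h.1 j i⟩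

theorem OrderPattern.argLt_iff {D : PraeDilator} {n m K : ℕ} {ss : Fin n → ThT D}
    {ts : Fin m → ThT D} {F : Fin n ↪o Fin K} {G : Fin m ↪o Fin K}
    (h : OrderPattern D ss ts F G) (σ : D.A n) (τ : D.A m) :
    ArgLt D ss σ ts τ ↔ D.map F σ < D.map G τ := by
  constructor
  · rintro ⟨k, f, g, h₁, h₂, hcover, hlt⟩
    obtain ⟨e, rfl, rfl⟩ := exists_orderEmbedding_lift f g F G hcover
      (fun i j => (h₁ i j).trans (h.1 i j).symm) (fun i j => (h₂ i j).trans (h.2 i j).symm)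
    rw [D.map_comp, D.map_comp]
    exact D.map_strictMono e _ _ hlt
  · intro hlt
    let d : Finset (Fin K) := Finset.univ.image F ∪ Finset.univ.image G
    obtain ⟨f, hf⟩ := exists_factor_orderEmbOfFin d F F.strictMono (fun i => by simp [d])
    obtain ⟨g, hg⟩ := exists_factor_orderEmbOfFin d G G.strictMono (fun i => by simp [d])
    have hF : F = f.trans (d.orderEmbOfFin rfl) := by
      ext i
      simp [hf]
    have hG : G = g.trans (d.orderEmbOfFin rfl) := by
      ext i
      simp [hg]
    refine ⟨d.card, f, g, fun i j => ?_, fun i j => ?_, fun p => ?_, ?_⟩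
    · rw [← h.1, ← hf, ← hg, OrderEmbedding.lt_iff_lt]
    · rw [← h.2, ← hf, ← hg, OrderEmbedding.lt_iff_lt]
    · have hp : d.orderEmbOfFin rfl p ∈ d := Finset.orderEmbOfFin_mem _ _ _
      simp only [d, Finset.mem_union, Finset.mem_image, Finset.mem_univ, true_and] at hp
      rcases hp with ⟨i, hi⟩ | ⟨j, hj⟩
      · exact Or.inl ⟨i, (d.orderEmbOfFin rfl).injective ((hf i).trans hi)⟩
      · exact Or.inr ⟨j, (d.orderEmbOfFin rfl).injective ((hg j).trans hj)⟩
    · rw [hF, hG, D.map_comp, D.map_comp, D.map_lt_map_iff] at hlt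
      exact hlt

theorem tlt_node_iff (D : PraeDilator) {n m : ℕ} (ss : Fin n → ThT D) (σ : D.A n)
    (ts : Fin m → ThT D) (τ : D.A m) :
    tlt D (.node n ss σ) (.node m ts τ) ↔
      (ArgLt D ss σ ts τ ∧
        ∀ h : 0 < n, tlt D (ss ⟨n - 1, Nat.sub_lt h Nat.one_pos⟩) (.node m ts τ)) ∨
      (∃ h : 0 < m,
        tlt D (.node n ss σ) (ts ⟨m - 1, Nat.sub_lt h Nat.one_pos⟩) ∨
        ThT.node n ss σ = ts ⟨m - 1, Nat.sub_lt h Nat.one_pos⟩) := by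
  rw [tlt, ArgLt]

theorem tlt_node_of_le_last (D : PraeDilator) {m : ℕ} (s : ThT D) (ts : Fin m → ThT D)
    (τ : D.A m) (h : 0 < m)
    (hs : tlt D s (ts ⟨m - 1, Nat.sub_lt h Nat.one_pos⟩) ∨
      s = ts ⟨m - 1, Nat.sub_lt h Nat.one_pos⟩) :
    tlt D s (.node m ts τ) := by
  cases s
  rw [tlt_node_iff]
  exact Or.inr ⟨h, hs⟩

/-- `tlt` is a linear order on the well-formed terms of size less than `N`. -/
structure LinearBelow (D : PraeDilator) (N : ℕ) : Prop where
  irrefl : ∀ s, ThTWF D s → tsizeT D s < N → ¬ tlt D s s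
  trans : ∀ s t u, ThTWF D s → ThTWF D t → ThTWF D u →
    tsizeT D s < N → tsizeT D t < N → tsizeT D u < N → tlt D s t → tlt D t u → tlt D s u
  trichotomy : ∀ s t, ThTWF D s → ThTWF D t → tsizeT D s < N → tsizeT D t < N →
    tlt D s t ∨ s = t ∨ tlt D t s

open Classical in
/-- The linear order on the well-formed terms of size less than `N`. -/
noncomputable abbrev LinearBelow.linearOrder {D : PraeDilator} {N : ℕ} (H : LinearBelow D N) :
    LinearOrder {t : ThT D // ThTWF D t ∧ tsizeT D t < N} :=
  haveI : IsStrictTotalOrder {t : ThT D // ThTWF D t ∧ tsizeT D t < N}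
      (fun s t => tlt D s.1 t.1) :=
    { irrefl := fun s => H.irrefl s.1 s.2.1 s.2.2
      trans := fun s t u => H.trans s.1 t.1 u.1 s.2.1 t.2.1 u.2.1 s.2.2 t.2.2 u.2.2
      trichotomous := fun s t h₁ h₂ => by
        rcases H.trichotomy s.1 t.1 s.2.1 t.2.1 s.2.2 t.2.2 with h | h | h
        · exact absurd h h₁
        · exact Subtype.ext h
        · exact absurd h h₂ }
  linearOrderOfSTO (fun s t => tlt D s.1 t.1)

theorem LinearBelow.exists_orderPattern {D : PraeDilator} {N : ℕ} (H : LinearBelow D N)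
    {n m l : ℕ} (ss : Fin n → ThT D) (ts : Fin m → ThT D) (us : Fin l → ThT D)
    (hs : ∀ i, ThTWF D (ss i) ∧ tsizeT D (ss i) < N)
    (ht : ∀ i, ThTWF D (ts i) ∧ tsizeT D (ts i) < N)
    (hu : ∀ i, ThTWF D (us i) ∧ tsizeT D (us i) < N)
    (ms : ∀ i j, i < j → tlt D (ss i) (ss j)) (mt : ∀ i j, i < j → tlt D (ts i) (ts j))
    (mu : ∀ i j, i < j → tlt D (us i) (us j)) :
    ∃ (K : ℕ) (F : Fin n ↪o Fin K) (G : Fin m ↪o Fin K) (E : Fin l ↪o Fin K),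
      OrderPattern D ss ts F G ∧ OrderPattern D ts us G E ∧ OrderPattern D ss us F E := by
  classical
  let := H.linearOrder
  let a : Fin n → {t : ThT D // ThTWF D t ∧ tsizeT D t < N} := fun i => ⟨ss i, hs i⟩
  let b : Fin m → {t : ThT D // ThTWF D t ∧ tsizeT D t < N} := fun i => ⟨ts i, ht i⟩
  let c : Fin l → {t : ThT D // ThTWF D t ∧ tsizeT D t < N} := fun i => ⟨us i, hu i⟩
  let d := Finset.univ.image a ∪ Finset.univ.image b ∪ Finset.univ.image c
  obtain ⟨F, hF⟩ := exists_factor_orderEmbOfFin d a (fun i j h => ms i j h) (fun i => by simp [d])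
  obtain ⟨G, hG⟩ := exists_factor_orderEmbOfFin d b (fun i j h => mt i j h) (fun i => by simp [d])
  obtain ⟨E, hE⟩ := exists_factor_orderEmbOfFin d c (fun i j h => mu i j h) (fun i => by simp [d])
  refine ⟨d.card, F, G, E, ⟨fun i j => ?_, fun i j => ?_⟩, ⟨fun i j => ?_, fun i j => ?_⟩,
    ⟨fun i j => ?_, fun i j => ?_⟩⟩ <;>
  · rw [← (d.orderEmbOfFin rfl).lt_iff_lt]
    simp only [hF, hG, hE]
    rfl

theorem ThTWF.of_node {D : PraeDilator} {n : ℕ} {ss : Fin n → ThT D} {σ : D.A n}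
    (h : ThTWF D (.node n ss σ)) :
    (∀ i, ThTWF D (ss i)) ∧ (∀ i j : Fin n, i < j → tlt D (ss i) (ss j)) ∧
      D.supp n σ = Finset.univ := by
  cases h with
  | node _ _ _ hwf hmono hsupp => exact ⟨hwf, hmono, hsupp⟩

theorem ThTWF.arg_tlt {D : PraeDilator} {m : ℕ} {ts : Fin m → ThT D} {τ : D.A m}
    (h : ThTWF D (.node m ts τ)) (j : Fin m) : tlt D (ts j) (.node m ts τ) := by
  have hm : 0 < m := j.pos
  apply tlt_node_of_le_last D _ _ _ hm
  by_cases hj : j < ⟨m - 1, Nat.sub_lt hm Nat.one_pos⟩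
  · exact Or.inl (h.of_node.2.1 _ _ hj)
  · refine Or.inr (congrArg ts (Fin.ext ?_))
    have : ¬ (j : ℕ) < m - 1 := hj
    have := j.2
    simp only
    omega

theorem LinearBelow.trans_succ {D : PraeDilator} {N : ℕ} (H : LinearBelow D N) (M : ℕ) :
    ∀ s t u, ThTWF D s → ThTWF D t → ThTWF D u →
      tsizeT D s < N + 1 → tsizeT D t < N + 1 → tsizeT D u < N + 1 →
      tsizeT D s + tsizeT D t + tsizeT D u < M → tlt D s t → tlt D t u → tlt D s u := by
  induction M with
  | zero => intros; omega
  | succ M ih =>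
    rintro ⟨n, ss, σ⟩ ⟨m, ts, τ⟩ ⟨l, us, ρ⟩ ws wt wu hs ht hu hM hst htu
    obtain ⟨wss, ms, -⟩ := ws.of_node
    obtain ⟨wts, mt, -⟩ := wt.of_node
    obtain ⟨wus, mu, -⟩ := wu.of_node
    have zs := tsizeT_lt D n ss σ
    have zt := tsizeT_lt D m ts τ
    have zu := tsizeT_lt D l us ρ
    rcases (tlt_node_iff D ts τ us ρ).1 htu with ⟨htu₁, htu₂⟩ | ⟨hl, htu'⟩
    · rcases (tlt_node_iff D ss σ ts τ).1 hst with ⟨hst₁, hst₂⟩ | ⟨hm, hst'⟩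
      · rw [tlt_node_iff]
        refine Or.inl ⟨?_, fun hn => ?_⟩
        · obtain ⟨K, F, G, E, h₁, h₂, h₃⟩ := H.exists_orderPattern ss ts us
            (fun i => ⟨wss i, by have := zs i; omega⟩) (fun i => ⟨wts i, by have := zt i; omega⟩)
            (fun i => ⟨wus i, by have := zu i; omega⟩) ms mt mu
          rw [h₃.argLt_iff]
          exact ((h₁.argLt_iff _ _).1 hst₁).trans ((h₂.argLt_iff _ _).1 htu₁)
        · have := zs ⟨n - 1, Nat.sub_lt hn Nat.one_pos⟩
          exact ih _ _ _ (wss _) wt wu (by omega) ht hu (by omega) (hst₂ hn) htu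
      · rcases hst' with h | h
        · have := zt ⟨m - 1, Nat.sub_lt hm Nat.one_pos⟩
          exact ih _ _ _ ws (wts _) wu hs (by omega) hu (by omega) h (htu₂ hm)
        · rw [h]
          exact htu₂ hm
    · refine tlt_node_of_le_last D _ _ _ hl (Or.inl ?_)
      rcases htu' with h | h
      · have := zu ⟨l - 1, Nat.sub_lt hl Nat.one_pos⟩
        exact ih _ _ _ ws wt (wus _) hs ht (by omega) (by omega) hst h
      · rw [← h]
        exact hst

theorem LinearBelow.trichotomy_succ {D : PraeDilator} {N : ℕ} (H : LinearBelow D N) (M : ℕ) :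
    ∀ s t, ThTWF D s → ThTWF D t → tsizeT D s < N + 1 → tsizeT D t < N + 1 →
      tsizeT D s + tsizeT D t < M → tlt D s t ∨ s = t ∨ tlt D t s := by
  induction M with
  | zero => intros; omega
  | succ M ih =>
    rintro ⟨n, ss, σ⟩ ⟨m, ts, τ⟩ ws wt hs ht hM
    obtain ⟨wss, ms, hσ⟩ := ws.of_node
    obtain ⟨wts, mt, hτ⟩ := wt.of_node
    have zs := tsizeT_lt D n ss σ
    have zt := tsizeT_lt D m ts τ
    have bs : ∀ i, ThTWF D (ss i) ∧ tsizeT D (ss i) < N :=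
      fun i => ⟨wss i, by have := zs i; omega⟩
    have bt : ∀ i, ThTWF D (ts i) ∧ tsizeT D (ts i) < N :=
      fun i => ⟨wts i, by have := zt i; omega⟩
    obtain ⟨K, F, G, -, h, -, -⟩ := H.exists_orderPattern ss ts ts bs bt bt ms mt mt
    rcases lt_trichotomy (D.map F σ) (D.map G τ) with hlt | heq | hgt
    · have harg := (h.argLt_iff σ τ).2 hlt
      by_cases hn : 0 < n
      · have hz := zs ⟨n - 1, Nat.sub_lt hn Nat.one_pos⟩
        rcases ih _ _ (wss ⟨n - 1, Nat.sub_lt hn Nat.one_pos⟩) wt (by omega) ht (by omega)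
          with h' | h' | h'
        · exact Or.inl ((tlt_node_iff D _ _ _ _).2 (Or.inl ⟨harg, fun _ => h'⟩))
        · exact Or.inr (Or.inr (tlt_node_of_le_last D _ _ _ hn (Or.inr h'.symm)))
        · exact Or.inr (Or.inr (tlt_node_of_le_last D _ _ _ hn (Or.inl h')))
      · exact Or.inl ((tlt_node_iff D _ _ _ _).2 (Or.inl ⟨harg, fun h => absurd h hn⟩))
    · obtain ⟨rfl, rfl, rfl⟩ := D.eq_of_map_eq hσ hτ F G heq
      have hss : ss = ts := by
        funext i
        rcases H.trichotomy _ _ (bs i).1 (bt i).1 (bs i).2 (bt i).2 with h' | h' | h'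
        · exact absurd ((h.1 i i).2 h') (lt_irrefl _)
        · exact h'
        · exact absurd ((h.2 i i).2 h') (lt_irrefl _)
      subst hss
      exact Or.inr (Or.inl rfl)
    · have harg := (h.symm.argLt_iff τ σ).2 hgt
      by_cases hm : 0 < m
      · have hz := zt ⟨m - 1, Nat.sub_lt hm Nat.one_pos⟩
        rcases ih _ _ ws (wts ⟨m - 1, Nat.sub_lt hm Nat.one_pos⟩) hs (by omega) (by omega)
          with h' | h' | h'
        · exact Or.inl (tlt_node_of_le_last D _ _ _ hm (Or.inl h'))
        · exact Or.inl (tlt_node_of_le_last D _ _ _ hm (Or.inr h'))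
        · exact Or.inr (Or.inr ((tlt_node_iff D _ _ _ _).2 (Or.inl ⟨harg, fun _ => h'⟩)))
      · exact Or.inr (Or.inr ((tlt_node_iff D _ _ _ _).2 (Or.inl ⟨harg, fun h => absurd h hm⟩)))

theorem LinearBelow.irrefl_succ {D : PraeDilator} {N : ℕ} (H : LinearBelow D N) :
    ∀ s, ThTWF D s → tsizeT D s < N + 1 → ¬ tlt D s s := by
  rintro ⟨n, ss, σ⟩ ws hs hlt
  obtain ⟨wss, ms, -⟩ := ws.of_node
  have zs := tsizeT_lt D n ss σ
  have bs : ∀ i, ThTWF D (ss i) ∧ tsizeT D (ss i) < N :=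
    fun i => ⟨wss i, by have := zs i; omega⟩
  rcases (tlt_node_iff D ss σ ss σ).1 hlt with ⟨⟨k, f, g, h₁, h₂, -, hfg⟩, -⟩ | ⟨hn, h | h⟩
  · have hfg' : f = g := by
      apply DFunLike.ext
      intro i
      have hi := H.irrefl _ (bs i).1 (bs i).2
      exact le_antisymm (not_lt.1 fun h => hi ((h₂ i i).1 h))
        (not_lt.1 fun h => hi ((h₁ i i).1 h))
    subst hfg'
    exact lt_irrefl _ hfg
  · have hb := bs ⟨n - 1, Nat.sub_lt hn Nat.one_pos⟩
    exact H.irrefl _ hb.1 hb.2 (H.trans_succ _ _ _ _ hb.1 ws hb.1 (by omega) hs (by omega)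
      (Nat.lt_succ_self _) (ws.arg_tlt _) h)
  · have := zs ⟨n - 1, Nat.sub_lt hn Nat.one_pos⟩
    rw [← h] at this
    exact lt_irrefl _ this

theorem linearBelow (D : PraeDilator) (N : ℕ) : LinearBelow D N := by
  induction N with
  | zero => constructor <;> intros <;> omega
  | succ N H =>
    exact ⟨H.irrefl_succ,
      fun s t u ws wt wu hs ht hu =>
        H.trans_succ _ s t u ws wt wu hs ht hu (Nat.lt_succ_self _),
      fun s t ws wt hs ht => H.trichotomy_succ _ s t ws wt hs ht (Nat.lt_succ_self _)⟩

/-- For any coded prae-dilator `T`, the relation `<_{ϑ(T)}` is a linear order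
on `ϑ(T)`: it is irreflexive, transitive, and any two distinct terms are comparable. -/
theorem thT_linearOrder (D : PraeDilator) :
    (∀ s : {t : ThT D // ThTWF D t}, ¬ tlt D s.val s.val) ∧
    (∀ s t u : {t : ThT D // ThTWF D t},
      tlt D s.val t.val → tlt D t.val u.val → tlt D s.val u.val) ∧
    (∀ s t : {t : ThT D // ThTWF D t}, s ≠ t → tlt D s.val t.val ∨ tlt D t.val s.val) := by
  refine ⟨fun s => ?_, fun s t u => ?_, fun s t hst => ?_⟩
  · exact (linearBelow D _).irrefl s.1 s.2 (Nat.lt_succ_self _)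
  · exact (linearBelow D (tsizeT D s.1 + tsizeT D t.1 + tsizeT D u.1 + 1)).trans s.1 t.1 u.1
      s.2 t.2 u.2 (by omega) (by omega) (by omega)
  · rcases (linearBelow D (tsizeT D s.1 + tsizeT D t.1 + 1)).trichotomy s.1 t.1 s.2 t.2
      (by omega) (by omega) with h | h | h
    · exact Or.inl h
    · exact absurd (Subtype.ext h) hst
    · exact Or.inr h
end

section
/- If T is a coded dilator, i.e. a coded prae-dilator such that D^T_X is well-founded for every well-order X, then the linear order ϑ(T) is well-founded. -/
namespace PraeDilator

variable {D : PraeDilator} {n m k : ℕ}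

theorem map_strictMono' (f : Fin n ↪o Fin m) : StrictMono (D.map f) :=
  fun σ τ h => D.map_strictMono f σ τ h

/-- An element of `D^T_X`, with the finite subset of `X` given by its increasing enumeration. -/
structure Rep (D : PraeDilator) (X : Type) [LinearOrder X] where
  n : ℕ
  e : Fin n ↪o X
  σ : D.A n
  hsupp : D.supp n σ = Finset.univ

variable {X : Type} [LinearOrder X]

/-- The order of `D^T_X` on enumerated elements, comparing in any common finite suborder. -/
def Rep.Lt (x y : Rep D X) : Prop :=
  ∃ (k : ℕ) (f : Fin x.n ↪o Fin k) (g : Fin y.n ↪o Fin k) (e : Fin k ↪o X),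
    f.trans e = x.e ∧ g.trans e = y.e ∧ D.map f x.σ < D.map g y.σ

theorem supp_cast (h : n = m) (σ : D.A n) (hσ : D.supp n σ = Finset.univ) :
    D.supp m (D.map (Fin.castOrderIso h).toOrderEmbedding σ) = Finset.univ := by
  subst h
  exact (congrArg (D.supp n) (D.map_id n σ)).trans hσ

/-- The element of `D^T_X` given by an enumerated element. -/
def Rep.toDApp (x : Rep D X) : DApp D X where
  a := Finset.univ.map x.e.toEmbedding
  σ := D.map (Fin.castOrderIso (by simp)).toOrderEmbedding x.σ
  hsupp := supp_cast _ _ x.hsupp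

theorem Rep.map_toDApp_σ (x : Rep D X) (f : Fin x.toDApp.a.card ↪o Fin k) :
    D.map f x.toDApp.σ =
      D.map ((Fin.castOrderIso (by simp [toDApp])).toOrderEmbedding.trans f) x.σ :=
  (D.map_comp _ _ _).symm

theorem orderEmbOfFin_inclEmb {a d : Finset X} (h : a ⊆ d) (i : Fin a.card) :
    d.orderEmbOfFin rfl (inclEmb h i) = a.orderEmbOfFin rfl i := by
  have := (d.orderIsoOfFin rfl).apply_symm_apply ⟨a.orderEmbOfFin rfl i, h (a.orderEmbOfFin_mem rfl i)⟩
  exact congrArg Subtype.val this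

theorem orderEmbOfFin_map_univ (e : Fin n ↪o X) (i : Fin n)
    (h : n = (Finset.univ.map e.toEmbedding).card) :
    (Finset.univ.map e.toEmbedding).orderEmbOfFin rfl (Fin.castOrderIso h i) = e i := by
  have := Finset.orderEmbOfFin_unique' (s := Finset.univ.map e.toEmbedding) h.symm (f := e)
    (by simp)
  exact (DFunLike.congr_fun this i).symm

theorem exists_factor {d : Finset X} (e : Fin k ↪o X) (h : ∀ x ∈ d, ∃ i, e i = x) :
    ∃ ι : Fin d.card ↪o Fin k, ∀ i, e (ι i) = d.orderEmbOfFin rfl i := by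
  choose ι hι using fun i => h _ (d.orderEmbOfFin_mem rfl i)
  refine ⟨OrderEmbedding.ofStrictMono ι fun i j hij => ?_, hι⟩
  rw [← e.lt_iff_lt, hι, hι]
  exact (d.orderEmbOfFin rfl).strictMono hij

theorem Rep.Lt.toDApp {x y : Rep D X} (h : x.Lt y) : DLt D X x.toDApp y.toDApp := by
  obtain ⟨k, f, g, e, hf, hg, hlt⟩ := h
  obtain ⟨ι, hι⟩ := exists_factor (d := x.toDApp.a ∪ y.toDApp.a) e (by
    intro z hz
    rcases Finset.mem_union.1 hz with hz | hz
    · obtain ⟨i, -, rfl⟩ := Finset.mem_map.1 hz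
      exact ⟨f i, DFunLike.congr_fun hf i⟩
    · obtain ⟨i, -, rfl⟩ := Finset.mem_map.1 hz
      exact ⟨g i, DFunLike.congr_fun hg i⟩)
  rw [DLt, ← (map_strictMono' ι).lt_iff_lt]
  have hx : D.map ι (D.map (inclEmb Finset.subset_union_left) x.toDApp.σ) = D.map f x.σ := by
    rw [← D.map_comp, Rep.map_toDApp_σ]
    congr 1
    ext i : 1
    apply e.injective
    refine (hι _).trans ((orderEmbOfFin_inclEmb _ _).trans
      ((orderEmbOfFin_map_univ _ _ _).trans (DFunLike.congr_fun hf i).symm))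
  have hy : D.map ι (D.map (inclEmb Finset.subset_union_right) y.toDApp.σ) = D.map g y.σ := by
    rw [← D.map_comp, Rep.map_toDApp_σ]
    congr 1
    ext i : 1
    apply e.injective
    refine (hι _).trans ((orderEmbOfFin_inclEmb _ _).trans
      ((orderEmbOfFin_map_univ _ _ _).trans (DFunLike.congr_fun hg i).symm))
  rw [hx, hy]
  exact hlt

theorem Rep.wellFounded_Lt (h : WellFounded (DLt D X)) : WellFounded (Rep.Lt (D := D) (X := X)) :=
  Subrelation.wf (fun h => h.toDApp) (InvImage.wf Rep.toDApp h)

end PraeDilator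

open Cardinal Ordinal in
/-- For every `B` there is a well-order of uncountable regular type exceeding `B`. -/
theorem exists_regular_wellOrder (B : Type) :
    ∃ (X : Type) (_ : LinearOrder X), WellFoundedLT X ∧ Nonempty X ∧
      (∀ F : ℕ → X, ∃ γ, ∀ n, F n < γ) ∧
      ∀ (β : X) (J : Type) (ι : J → List (Set.Iio β) × B), Function.Injective ι →
        ∀ F : J → X, ∃ γ, ∀ j, F j < γ := by
  let μ : Cardinal.{0} := max ℵ₀ #B
  let κ := Order.succ μ
  have hμ : ℵ₀ ≤ μ := le_max_left _ _
  have hreg : κ.IsRegular := isRegular_succ hμ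
  have hμκ : μ < κ := Order.lt_succ μ
  have hbd : ∀ (J : Type), #J < κ → ∀ F : J → κ.ord.ToType, ∃ γ, ∀ j, F j < γ := by
    intro J hJ F
    by_contra! hcon
    have hc : IsCofinal (Set.range F) := fun γ => by
      obtain ⟨j, hj⟩ := hcon γ
      exact ⟨F j, ⟨j, rfl⟩, hj⟩
    have h1 := (Order.cof_le hc).trans mk_range_le
    rw [cof_toType, hreg.cof_ord] at h1
    exact h1.not_gt hJ
  refine ⟨κ.ord.ToType, inferInstance, inferInstance, ?_, ?_, ?_⟩
  · rw [nonempty_toType_iff]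
    simpa using hreg.pos.ne'
  · exact hbd ℕ (by simpa using hμ.trans_lt hμκ)
  · intro β J ι hι
    refine hbd J ((mk_le_of_injective hι).trans_lt ?_)
    have h1 : #(Set.Iio β) < κ := by
      simpa using mk_Iio_lt β (by simp)
    have hB : #B ≤ μ := le_max_right _ _
    have h2 : #(List (Set.Iio β)) ≤ μ :=
      (mk_list_le_max _).trans (max_le hμ (Order.lt_succ_iff.1 h1))
    rw [mk_prod, Cardinal.lift_id, Cardinal.lift_id]
    exact (mul_le_of_le hμ h2 hB).trans_lt hμκ

namespace PraeDilator

variable {D : PraeDilator} {X : Type} [LinearOrder X]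

theorem Rep.ext_list {x y : Rep D X} (hl : List.ofFn x.e = List.ofFn y.e)
    (hσ : (⟨x.n, x.σ⟩ : Σ n, D.A n) = ⟨y.n, y.σ⟩) : x = y := by
  obtain ⟨n, e, σ, h⟩ := x
  obtain ⟨m, e', τ, h'⟩ := y
  obtain ⟨rfl, hστ⟩ := Sigma.mk.inj hσ
  obtain rfl := eq_of_heq hστ
  obtain rfl : e = e' := DFunLike.coe_injective (List.ofFn_injective hl)
  rfl

/-- Every function on `D^T_X` has arbitrarily large closure points if `X` is suitably regular. -/
theorem Rep.exists_closed [WellFoundedLT X]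
    (hω : ∀ F : ℕ → X, ∃ γ, ∀ n, F n < γ)
    (hbd : ∀ (β : X) (J : Type) (ι : J → List (Set.Iio β) × Σ n, D.A n), Function.Injective ι →
        ∀ F : J → X, ∃ γ, ∀ j, F j < γ) (F : Rep D X → X) (α₀ : X) :
    ∃ α, α₀ < α ∧ ∀ r : Rep D X, (∀ i, r.e i < α) → F r < α := by
  have hstep : ∀ β : X, ∃ γ, β < γ ∧ ∀ r : Rep D X, (∀ i, r.e i < β) → F r < γ := by
    intro β
    obtain ⟨γ₁, h₁⟩ := hω fun _ => β
    obtain ⟨γ₂, h₂⟩ := hbd β {r : Rep D X // ∀ i, r.e i < β}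
      (fun r => (List.ofFn fun i => ⟨r.1.e i, r.2 i⟩, ⟨r.1.n, r.1.σ⟩))
      (fun r r' h => by
        obtain ⟨hl, hσ⟩ := Prod.mk.inj h
        refine Subtype.ext (Rep.ext_list ?_ hσ)
        have := congrArg (List.map Subtype.val) hl
        simpa [List.map_ofFn, Function.comp_def] using this) (fun r => F r.1)
    exact ⟨max γ₁ γ₂, lt_max_of_lt_left (h₁ 0), fun r hr => lt_max_of_lt_right (h₂ ⟨r, hr⟩)⟩
  choose G hG hGF using hstep
  let u : ℕ → X := fun n => G^[n] α₀
  have hu : ∀ n, u (n + 1) = G (u n) := fun n => Function.iterate_succ_apply' G n α₀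
  have hmono : StrictMono u := strictMono_nat_of_lt_succ fun n => by rw [hu]; exact hG _
  obtain ⟨α, hα, hmin⟩ := WellFounded.has_min (wellFounded_lt (α := X)) {α | ∀ n, u n < α} (hω u)
  refine ⟨α, hα 0, fun r hr => ?_⟩
  have hex : ∀ i, ∃ n, r.e i ≤ u n := fun i => by
    by_contra! hcon
    exact hmin _ hcon (hr i)
  choose N hN using hex
  have : ∀ i, r.e i < u (Finset.univ.sup N + 1) := fun i =>
    (hN i).trans_lt (hmono (Nat.lt_succ_of_le (Finset.le_sup (Finset.mem_univ i))))
  exact (hGF _ r this).trans (hu _ ▸ hα _)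

/-- A collapse of `D^T_X` into `X`, i.e. a Bachmann–Howard fixed point. -/
theorem Rep.exists_collapse [WellFoundedLT X] [Nonempty X]
    (hω : ∀ F : ℕ → X, ∃ γ, ∀ n, F n < γ)
    (hbd : ∀ (β : X) (J : Type) (ι : J → List (Set.Iio β) × Σ n, D.A n), Function.Injective ι →
        ∀ F : J → X, ∃ γ, ∀ j, F j < γ) (hwf : WellFounded (Rep.Lt (D := D) (X := X))) :
    ∃ ϑ : Rep D X → X, (∀ r i, r.e i < ϑ r) ∧
      ∀ r s, r.Lt s → (∀ i, r.e i < ϑ s) → ϑ r < ϑ s := by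
  classical
  let C : (s : Rep D X) → (∀ r : Rep D X, r.Lt s → X) → X → Prop := fun s F α =>
    (∀ i, s.e i < α) ∧ ∀ r (h : r.Lt s), (∀ i, r.e i < α) → F r h < α
  have hC : ∀ s F, ∃ α, C s F α := by
    intro s F
    obtain ⟨α₀, hα₀⟩ : ∃ α₀, ∀ i, s.e i ≤ α₀ := by
      obtain ⟨γ, hγ⟩ := hω fun i => if h : i < s.n then s.e ⟨i, h⟩ else Classical.arbitrary X
      refine ⟨γ, fun i => ?_⟩
      simpa using (hγ i).le
    obtain ⟨α, h₁, h₂⟩ := Rep.exists_closed hω hbd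
      (fun r => if h : r.Lt s then F r h else Classical.arbitrary X) α₀
    exact ⟨α, fun i => (hα₀ i).trans_lt h₁, fun r h hr => by simpa [h] using h₂ r hr⟩
  let ϑ : Rep D X → X := hwf.fix fun s F => (hC s F).choose
  have hϑ : ∀ s, C s (fun r _ => ϑ r) (ϑ s) := fun s => by
    have : ϑ s = (hC s fun r _ => ϑ r).choose := hwf.fix_eq _ s
    rw [this]
    exact (hC s fun r _ => ϑ r).choose_spec
  exact ⟨ϑ, fun r => (hϑ r).1, fun r s h => (hϑ s).2 r h⟩

open Classical in
/-- The interpretation of terms of `ϑ(T)` in `X` given by a collapse. -/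
noncomputable def interp [Nonempty X] (ϑ : Rep D X → X) : ThT D → X
  | .node n ss σ =>
    if h : StrictMono (fun i => interp ϑ (ss i)) ∧ D.supp n σ = Finset.univ then
      ϑ ⟨n, OrderEmbedding.ofStrictMono _ h.1, σ, h.2⟩
    else Classical.arbitrary X

theorem eq_and_heq_of_map_eq {n m k : ℕ} (f : Fin n ↪o Fin k) (g : Fin m ↪o Fin k) (σ : D.A n)
    (τ : D.A m) (hσ : D.supp n σ = Finset.univ) (hτ : D.supp m τ = Finset.univ)
    (h : D.map f σ = D.map g τ) : ∃ _ : n = m, f ≍ g ∧ σ ≍ τ := by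
  have hr : Finset.univ.map f.toEmbedding = Finset.univ.map g.toEmbedding := by
    rw [← hσ, ← hτ, ← D.supp_natural, ← D.supp_natural, h]
  obtain rfl : n = m := by simpa using congrArg Finset.card hr
  obtain rfl : f = g := by
    have := congrArg (fun s : Finset (Fin k) => (s : Set (Fin k))) hr
    have hrange : Set.range f = Set.range g := by simpa using this
    exact OrderEmbedding.range_inj.1 hrange
  exact ⟨rfl, HEq.rfl, heq_of_eq ((map_strictMono' f).injective h)⟩

/-- Two finite increasing sequences have a common refinement enumerating exactly their union. -/
theorem exists_joint {n m : ℕ} (e : Fin n ↪o X) (e' : Fin m ↪o X) :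
    ∃ (k : ℕ) (f : Fin n ↪o Fin k) (g : Fin m ↪o Fin k) (d : Fin k ↪o X),
      (∀ i, d (f i) = e i) ∧ (∀ j, d (g j) = e' j) ∧
      ∀ p, (∃ i, f i = p) ∨ ∃ j, g j = p := by
  let c : Finset X := Finset.univ.map e.toEmbedding ∪ Finset.univ.map e'.toEmbedding
  let d := c.orderEmbOfFin rfl
  have hd : ∀ x ∈ c, ∃ p, d p = x := fun x hx => by
    have : x ∈ Set.range d := by simpa [d] using hx
    exact this
  choose f hf using fun i => hd (e i) (by simp [c])
  choose g hg using fun j => hd (e' j) (by simp [c])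
  refine ⟨c.card, .ofStrictMono f fun i j h => ?_, .ofStrictMono g fun i j h => ?_, d, hf, hg,
    fun p => ?_⟩
  · rw [← d.lt_iff_lt, hf, hf]
    exact e.strictMono h
  · rw [← d.lt_iff_lt, hg, hg]
    exact e'.strictMono h
  · rcases Finset.mem_union.1 (c.orderEmbOfFin_mem rfl p) with hp | hp
    · obtain ⟨i, -, hi⟩ := Finset.mem_map.1 hp
      exact .inl ⟨i, d.injective ((hf i).trans hi)⟩
    · obtain ⟨j, -, hj⟩ := Finset.mem_map.1 hp
      exact .inr ⟨j, d.injective ((hg j).trans hj)⟩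

theorem tsizeT_add_lt {n : ℕ} (ss : Fin n → ThT D) (σ : D.A n) {i j : Fin n} (h : i ≠ j) :
    tsizeT D (ss i) + tsizeT D (ss j) < tsizeT D (.node n ss σ) := by
  have := Finset.sum_le_univ_sum_of_nonneg (f := fun i => tsizeT D (ss i))
    (s := {i, j}) fun _ => Nat.zero_le _
  rw [Finset.sum_pair h] at this
  rw [tsizeT]
  omega

section interp

variable [Nonempty X] {ϑ : Rep D X → X}

theorem interp_node {n : ℕ} {ss : Fin n → ThT D} {σ : D.A n}
    (hs : StrictMono fun i => interp ϑ (ss i)) (hσ : D.supp n σ = Finset.univ) :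
    interp ϑ (.node n ss σ) = ϑ ⟨n, .ofStrictMono _ hs, σ, hσ⟩ := by
  rw [interp, dif_pos ⟨hs, hσ⟩]

theorem interp_lt_and_trichotomous (hϑ : ∀ r i, r.e i < ϑ r)
    (hϑlt : ∀ r s, r.Lt s → (∀ i, r.e i < ϑ s) → ϑ r < ϑ s) (N : ℕ) :
    ∀ s t : ThT D, ThTWF D s → ThTWF D t → tsizeT D s + tsizeT D t ≤ N →
      (tlt D s t → interp ϑ s < interp ϑ t) ∧ (tlt D s t ∨ s = t ∨ tlt D t s) := by
  induction N using Nat.strong_induction_on with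
  | _ N ih =>
  replace ih : ∀ s t : ThT D, ThTWF D s → ThTWF D t → tsizeT D s + tsizeT D t < N →
      (tlt D s t → interp ϑ s < interp ϑ t) ∧ (tlt D s t ∨ s = t ∨ tlt D t s) :=
    fun s t hs ht h => ih _ h s t hs ht le_rfl
  have ih_iff : ∀ s t : ThT D, ThTWF D s → ThTWF D t → tsizeT D s + tsizeT D t < N →
      (interp ϑ s < interp ϑ t ↔ tlt D s t) := fun s t hs ht h => by
    refine ⟨fun hlt => ?_, (ih s t hs ht h).1⟩
    rcases (ih s t hs ht h).2 with h' | rfl | h'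
    · exact h'
    · exact absurd hlt (lt_irrefl _)
    · exact absurd hlt ((ih t s ht hs (by omega)).1 h').not_gt
  have ih_inj : ∀ s t : ThT D, ThTWF D s → ThTWF D t → tsizeT D s + tsizeT D t < N →
      interp ϑ s = interp ϑ t → s = t := fun s t hs ht h heq => by
    rcases (ih s t hs ht h).2 with h' | h' | h'
    · exact absurd heq ((ih s t hs ht h).1 h').ne
    · exact h'
    · exact absurd heq ((ih t s ht hs (by omega)).1 h').ne'
  rintro _ _ (⟨n, ss, σ, hss, hsslt, hσ⟩) (⟨m, ts, τ, hts, htslt, hτ⟩) hN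
  have hs_size := tsizeT_lt D n ss σ
  have ht_size := tsizeT_lt D m ts τ
  have hS : StrictMono fun i => interp ϑ (ss i) := fun i j hij =>
    (ih _ _ (hss i) (hss j) (by have := tsizeT_add_lt ss σ hij.ne; omega)).1 (hsslt i j hij)
  have hT : StrictMono fun j => interp ϑ (ts j) := fun i j hij =>
    (ih _ _ (hts i) (hts j) (by have := tsizeT_add_lt ts τ hij.ne; omega)).1 (htslt i j hij)
  have hswf : ThTWF D (.node n ss σ) := .node n ss σ hss hsslt hσ
  have htwf : ThTWF D (.node m ts τ) := .node m ts τ hts htslt hτ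
  have hst_size : ∀ i j, tsizeT D (ss i) + tsizeT D (ts j) < N := fun i j => by
    have := hs_size i; have := ht_size j; omega
  have hst_iff : ∀ i j, interp ϑ (ss i) < interp ϑ (ts j) ↔ tlt D (ss i) (ts j) := fun i j =>
    ih_iff _ _ (hss i) (hts j) (hst_size i j)
  have hts_iff : ∀ i j, interp ϑ (ts j) < interp ϑ (ss i) ↔ tlt D (ts j) (ss i) := fun i j =>
    ih_iff _ _ (hts j) (hss i) (by have := hst_size i j; omega)
  have hs_arg : ∀ i, interp ϑ (ss i) < interp ϑ (.node n ss σ) := fun i => by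
    rw [interp_node hS hσ]
    exact hϑ ⟨n, .ofStrictMono _ hS, σ, hσ⟩ i
  have ht_arg : ∀ j, interp ϑ (ts j) < interp ϑ (.node m ts τ) := fun j => by
    rw [interp_node hT hτ]
    exact hϑ ⟨m, .ofStrictMono _ hT, τ, hτ⟩ j
  obtain ⟨k, f, g, d, hf, hg, hk⟩ :=
    exists_joint (OrderEmbedding.ofStrictMono _ hS) (OrderEmbedding.ofStrictMono _ hT)
  have hfg : ∀ i j, f i < g j ↔ tlt D (ss i) (ts j) := fun i j => by
    rw [← d.lt_iff_lt, hf, hg]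
    exact hst_iff i j
  have hgf : ∀ i j, g j < f i ↔ tlt D (ts j) (ss i) := fun i j => by
    rw [← d.lt_iff_lt, hf, hg]
    exact hts_iff i j
  refine ⟨fun hlt => ?_, ?_⟩
  · rw [tlt] at hlt
    rcases hlt with ⟨⟨k', f', g', hfg', hgf', hk', hmap⟩, hlast⟩ | ⟨hm, hle⟩
    · have harg : ∀ i, interp ϑ (ss i) < interp ϑ (.node m ts τ) := fun i => by
        have hn : 0 < n := i.pos
        refine lt_of_le_of_lt (hS.monotone (b := ⟨n - 1, by omega⟩) ?_)
          ((ih _ _ (hss _) htwf (by have := hs_size ⟨n - 1, by omega⟩; omega)).1 (hlast hn))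
        exact Fin.le_def.2 (Nat.le_sub_one_of_lt i.isLt)
      rw [interp_node hT hτ] at harg ⊢
      rw [interp_node hS hσ]
      refine hϑlt _ _ ?_ harg
      have hE : ∃ E : Fin k' → X, (∀ i, E (f' i) = interp ϑ (ss i)) ∧
          ∀ j, E (g' j) = interp ϑ (ts j) := by
        have hp : ∀ p, ∃ x, (∀ i, f' i = p → x = interp ϑ (ss i)) ∧
            ∀ j, g' j = p → x = interp ϑ (ts j) := by
          have hfg_eq : ∀ i j, f' i = g' j → interp ϑ (ss i) = interp ϑ (ts j) := fun i j h =>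
            le_antisymm (not_lt.1 fun h' => (((hgf' i j).2 ((hts_iff i j).1 h')).ne' h))
              (not_lt.1 fun h' => (((hfg' i j).2 ((hst_iff i j).1 h')).ne h))
          intro p
          rcases hk' p with ⟨i, rfl⟩ | ⟨j, rfl⟩
          · refine ⟨_, fun i' h => ?_, fun j h => hfg_eq i j h.symm⟩
            rw [f'.injective h]
          · refine ⟨_, fun i h => (hfg_eq i j h).symm, fun j' h => ?_⟩
            rw [g'.injective h]
        choose E hE₁ hE₂ using hp
        exact ⟨E, fun i => hE₁ _ i rfl, fun j => hE₂ _ j rfl⟩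
      obtain ⟨E, hEf, hEg⟩ := hE
      have hEmono : StrictMono E := by
        intro p q hpq
        rcases hk' p with ⟨i, rfl⟩ | ⟨j, rfl⟩ <;> rcases hk' q with ⟨i', rfl⟩ | ⟨j', rfl⟩
        · rw [hEf, hEf]
          exact hS (f'.lt_iff_lt.1 hpq)
        · rw [hEf, hEg]
          exact (hst_iff _ _).2 ((hfg' _ _).1 hpq)
        · rw [hEf, hEg]
          exact (hts_iff _ _).2 ((hgf' _ _).1 hpq)
        · rw [hEg, hEg]
          exact hT (g'.lt_iff_lt.1 hpq)
      exact ⟨k', f', g', .ofStrictMono E hEmono, RelEmbedding.ext hEf, RelEmbedding.ext hEg, hmap⟩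
    · rcases hle with hlt | heq
      · refine lt_trans ((ih _ _ hswf (hts _) ?_).1 hlt) (ht_arg _)
        have := ht_size ⟨m - 1, by omega⟩
        omega
      · rw [heq]
        exact ht_arg _
  · rcases lt_trichotomy (D.map f σ) (D.map g τ) with hmap | hmap | hmap
    · by_cases hlast : ∀ h : 0 < n,
          tlt D (ss ⟨n - 1, Nat.sub_lt h Nat.one_pos⟩) (.node m ts τ)
      · left
        rw [tlt]
        exact .inl ⟨⟨k, f, g, hfg, hgf, hk, hmap⟩, hlast⟩
      · right; right
        push Not at hlast
        obtain ⟨hn, hlast⟩ := hlast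
        rw [tlt]
        refine .inr ⟨hn, ?_⟩
        rcases (ih _ _ (hss ⟨n - 1, by omega⟩) htwf
          (by have := hs_size ⟨n - 1, by omega⟩; omega)).2 with h | h | h
        · exact absurd h hlast
        · exact .inr h.symm
        · exact .inl h
    · right; left
      obtain ⟨rfl, hfg_eq, hστ⟩ := eq_and_heq_of_map_eq f g σ τ hσ hτ hmap
      obtain rfl := eq_of_heq hfg_eq
      obtain rfl := eq_of_heq hστ
      congr 1
      funext i
      exact ih_inj _ _ (hss i) (hts i) (hst_size i i) ((hf i).symm.trans (hg i))
    · by_cases hlast : ∀ h : 0 < m,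
          tlt D (ts ⟨m - 1, Nat.sub_lt h Nat.one_pos⟩) (.node n ss σ)
      · right; right
        rw [tlt]
        exact .inl ⟨⟨k, g, f, fun j i => hgf i j, fun j i => hfg i j, fun p => (hk p).symm, hmap⟩,
          hlast⟩
      · left
        push Not at hlast
        obtain ⟨hm, hlast⟩ := hlast
        rw [tlt]
        refine .inr ⟨hm, ?_⟩
        rcases (ih _ _ (hts ⟨m - 1, by omega⟩) hswf
          (by have := ht_size ⟨m - 1, by omega⟩; omega)).2 with h | h | h
        · exact absurd h hlast
        · exact .inr h.symm
        · exact .inl h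

end interp

end PraeDilator

/-- If `T` is a coded dilator — a coded prae-dilator such that `D^T_X` is
well-founded for every well-order `X` — then the linear order `ϑ(T)` is well-founded. -/
theorem thT_wellFounded_of_dilator (D : PraeDilator)
    (hdil : ∀ (X : Type) (L : LinearOrder X), WellFounded L.lt → WellFounded (@DLt D X L)) :
    WellFounded (fun s t : {t : ThT D // ThTWF D t} => tlt D s.val t.val) := by
  obtain ⟨X, L, hX, hne, hω, hbd⟩ := exists_regular_wellOrder (Σ n, D.A n)
  obtain ⟨ϑ, hϑ, hϑlt⟩ := PraeDilator.Rep.exists_collapse hω hbd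
    (PraeDilator.Rep.wellFounded_Lt (hdil X L hX.wf))
  exact Subrelation.wf
    (fun {s t} h =>
      (PraeDilator.interp_lt_and_trichotomous hϑ hϑlt _ s.1 t.1 s.2 t.2 le_rfl).1 h)
    (InvImage.wf (fun s : {t : ThT D // ThTWF D t} => PraeDilator.interp ϑ s.1) hX.wf)
end
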